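/- If G is a simple graph on n ≥ 6 vertices that contains no cycle with two chords incident to a common vertex, then e(G) ≤ 3n - 9. -/

import Mathlib

open SimpleGraph

/-- A chord of the cycle `c` in `G`: an edge of `G` whose endpoints lie on `c`
but which is not itself an edge of `c`. -/
def IsChord {V : Type*} (G : SimpleGraph V) {v : V} (c : G.Walk v v) (e : Sym2 V) : Prop :=
  e ∈ G.edgeSet ∧ e ∉ c.edges ∧ ∀ x ∈ e, x ∈ c.support

/-- `G` contains a doubly chorded cycle: a cycle with at least two chords. -/
def HasDCC {V : Type*} (G : SimpleGraph V) : Prop :=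
  ∃ (v : V) (c : G.Walk v v), c.IsCycle ∧
    ∃ e₁ e₂ : Sym2 V, e₁ ≠ e₂ ∧ IsChord G c e₁ ∧ IsChord G c e₂

/-- `G` contains a cycle with two chords incident to a common vertex. -/
def HasDCC1 {V : Type*} (G : SimpleGraph V) : Prop :=
  ∃ (v : V) (c : G.Walk v v), c.IsCycle ∧
    ∃ e₁ e₂ : Sym2 V, e₁ ≠ e₂ ∧ IsChord G c e₁ ∧ IsChord G c e₂ ∧
      ∃ w : V, w ∈ e₁ ∧ w ∈ e₂

/-- A path avoiding `w` whose ends and two further vertices are adjacent to `w` closes up to a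
cycle with two chords at `w`. -/
theorem hasDCC1_of_isPath {V : Type*} {G : SimpleGraph V} {w u v x y : V} (p : G.Walk u v)
    (hp : p.IsPath) (hw : w ∉ p.support) (huv : u ≠ v) (hwu : G.Adj w u) (hwv : G.Adj w v)
    (hx : x ∈ p.support) (hy : y ∈ p.support) (hxy : x ≠ y) (hxu : x ≠ u) (hxv : x ≠ v)
    (hyu : y ≠ u) (hyv : y ≠ v) (hwx : G.Adj w x) (hwy : G.Adj w y) : HasDCC1 G := by
  have hedge (z : V) : s(w, z) ∉ p.edges := fun h => hw (p.fst_mem_support_of_mem_edges h)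
  have chord {z : V} (hz : z ∈ p.support) (hzu : z ≠ u) (hzv : z ≠ v) (hwz : G.Adj w z) :
      IsChord G (Walk.cons hwu (p.concat hwv.symm)) s(w, z) := by
    refine ⟨hwz, ?_, ?_⟩
    · simp [Walk.edges_concat, hedge, hzu, hzv, hwz.ne', hwv.ne]
    · simp [Walk.support_concat, hz]
  refine ⟨w, Walk.cons hwu (p.concat hwv.symm), ?_, s(w, x), s(w, y), ?_, chord hx hxu hxv hwx,
    chord hy hyu hyv hwy, w, by simp, by simp⟩
  · rw [Walk.cons_isCycle_iff]
    refine ⟨hp.concat hw hwv.symm, ?_⟩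
    simp [Walk.edges_concat, hedge, huv, hwv.ne]
  · rwa [Ne, Sym2.congr_right]

/-- A path can be cut off at the last of its vertices lying in a given set. -/
theorem exists_isPath_to_last_mem {V : Type*} {G : SimpleGraph V} (N : Set V) {a b : V}
    (p : G.Walk a b) (hp : p.IsPath) (hN : ∃ z ∈ N, z ∈ p.support) :
    ∃ z ∈ N, ∃ q : G.Walk a z, q.IsPath ∧ q.support ⊆ p.support ∧
      ∀ x ∈ N, x ∈ p.support → x ∈ q.support := by
  induction p with
  | nil =>
    obtain ⟨z, hzN, hz⟩ := hN
    simp only [Walk.support_nil, List.mem_singleton] at hz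
    subst hz
    exact ⟨z, hzN, Walk.nil, hp, fun _ h => h, fun _ _ h => h⟩
  | @cons a c b h p ih =>
    rw [Walk.cons_isPath_iff] at hp
    by_cases hex : ∃ z ∈ N, z ∈ p.support
    · obtain ⟨z, hzN, q, hq, hqp, hNq⟩ := ih hp.1 hex
      refine ⟨z, hzN, Walk.cons h q, hq.cons fun ha => hp.2 (hqp ha), ?_, ?_⟩
      · simpa using List.subset_cons_of_subset _ hqp
      · intro x hx hxs
        simp only [Walk.support_cons, List.mem_cons] at hxs ⊢
        exact hxs.imp_right (hNq x hx)
    · obtain ⟨z, hzN, hz⟩ := hN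
      simp only [Walk.support_cons, List.mem_cons] at hz
      obtain rfl : z = a := hz.resolve_right fun h => hex ⟨z, hzN, h⟩
      refine ⟨z, hzN, Walk.nil, by simp, by simp, ?_⟩
      intro x hx hxs
      simp only [Walk.support_cons, List.mem_cons] at hxs
      simpa using hxs.resolve_right fun h => hex ⟨x, hx, h⟩

theorem hasDCC1_of_four_le_degree {V : Type*} [Fintype V] [Nonempty V] (G : SimpleGraph V)
    [DecidableRel G.Adj] (hG : ∀ v, 4 ≤ G.degree v) : HasDCC1 G := by
  classical
  obtain ⟨u, v, p, hp, hmax⟩ := Walk.exists_isPath_forall_isPath_length_le_length G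
  have hnbr : ∀ x, G.Adj u x → x ∈ p.support := by
    intro x hx
    by_contra hxp
    have := hmax _ _ (Walk.cons hx.symm p) (hp.cons hxp)
    simp at this
  cases p with
  | nil =>
    have hpos : 0 < G.degree u := by have := hG u; omega
    obtain ⟨x, hx⟩ := (G.degree_pos_iff_exists_adj u).1 hpos
    have := hnbr x hx
    simp only [Walk.support_nil, List.mem_singleton] at this
    exact absurd this hx.ne'
  | @cons _ a _ hua p =>
    rw [Walk.cons_isPath_iff] at hp
    have hnbr' : ∀ x, G.Adj u x → x ∈ p.support := fun x hx =>
      (List.mem_cons.1 (hnbr x hx)).resolve_left hx.ne'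
    obtain ⟨z, hz, q, hq, hqp, hNq⟩ :=
      exists_isPath_to_last_mem {x | G.Adj u x} p hp.1 ⟨a, hua, p.start_mem_support⟩
    have hcard : 1 < ((G.neighborFinset u).erase a |>.erase z).card := by
      have h₁ := Finset.pred_card_le_card_erase (s := G.neighborFinset u) (a := a)
      have h₂ := Finset.pred_card_le_card_erase (s := (G.neighborFinset u).erase a) (a := z)
      have h₃ := hG u
      rw [← G.card_neighborFinset_eq_degree] at h₃
      omega
    obtain ⟨x, hx, y, hy, hxy⟩ := Finset.one_lt_card.1 hcard
    simp only [Finset.mem_erase, mem_neighborFinset] at hx hy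
    have haz : a ≠ z := by
      rintro rfl
      have := hNq x hx.2.2 (hnbr' x hx.2.2)
      rw [(Walk.isPath_iff_nil.1 hq).eq_nil] at this
      simp [hx.1] at this
    exact hasDCC1_of_isPath q hq (fun h => hp.2 (hqp h)) haz hua hz
      (hNq x hx.2.2 (hnbr' x hx.2.2)) (hNq y hy.2.2 (hnbr' y hy.2.2)) hxy hx.2.1 hx.1 hy.2.1 hy.1
      hx.2.2 hy.2.2

theorem HasDCC1.map {V W : Type*} {G : SimpleGraph V} {H : SimpleGraph W} (f : G ↪g H)
    (h : HasDCC1 G) : HasDCC1 H := by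
  obtain ⟨v, c, hc, e₁, e₂, hne, h₁, h₂, w, hw₁, hw₂⟩ := h
  have chord {e : Sym2 V} (he : IsChord G c e) : IsChord H (c.map f.toHom) (e.map f) := by
    obtain ⟨heG, hec, hes⟩ := he
    refine ⟨(f.map_mem_edgeSet_iff).2 heG, ?_, ?_⟩
    · rw [Walk.edges_map]
      intro hmem
      obtain ⟨e', he', heq⟩ := List.mem_map.1 hmem
      exact hec (Sym2.map.injective f.injective heq ▸ he')
    · intro x hx
      obtain ⟨y, hy, rfl⟩ := Sym2.mem_map.1 hx
      rw [Walk.support_map]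
      exact List.mem_map_of_mem (hes y hy)
  exact ⟨f v, c.map f.toHom, hc.map f.injective, e₁.map f, e₂.map f,
    (Sym2.map.injective f.injective).ne hne, chord h₁, chord h₂, f w,
    Sym2.mem_map.2 ⟨w, hw₁, rfl⟩, Sym2.mem_map.2 ⟨w, hw₂, rfl⟩⟩

/-- The index in `{0, …, 14}` of an edge of the complete graph on `Fin 6`. -/
def edgeCode (i j : Fin 6) : ℕ := max i.1 j.1 * (max i.1 j.1 - 1) / 2 + min i.1 j.1

/-- The edge sets of graphs on the given six vertices that consist of a path, and of a further
vertex joined to both ends and two inner vertices of that path. -/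
def fanEdges : List (Fin 6) → List (List (Fin 6 × Fin 6))
  | [w, a, b, c, d, e] =>
    [[(w, a), (w, b), (w, c), (w, d), (a, b), (b, c), (c, d)],
     [(w, a), (w, b), (w, c), (w, e), (a, b), (b, c), (c, d), (d, e)],
     [(w, a), (w, b), (w, d), (w, e), (a, b), (b, c), (c, d), (d, e)]]
  | _ => []

/-- A set of edges of the complete graph on `Fin 6`, as a bit mask. -/
def edgeMask (l : List (Fin 6 × Fin 6)) : ℕ :=
  l.foldr (fun e m => 1 <<< edgeCode e.1 e.2 ||| m) 0

/-- All graphs of the form `fanEdges` on `Fin 6`, as bit masks. -/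
def fanMasks : List ℕ := ((List.finRange 6).permutations'.flatMap fanEdges).map edgeMask

/-- Whether every set of at most `b` indices below `k` is avoided by some mask in `ps`. -/
def avoidable : ℕ → ℕ → List ℕ → Bool
  | _, 0, ps => !ps.isEmpty
  | 0, _ + 1, ps => !ps.isEmpty
  | k + 1, b + 1, ps =>
    avoidable k (b + 1) ps && avoidable k b (ps.filter fun p => !p.testBit k)

theorem exists_mask_of_avoidable (f : ℕ → Prop) [DecidablePred f] (k b : ℕ) (ps : List ℕ)
    (h : avoidable k b ps = true) (hb : ((Finset.range k).filter fun i => ¬ f i).card ≤ b) :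
    ∃ p ∈ ps, ∀ i < k, p.testBit i = true → f i := by
  have nonempty {ps : List ℕ} (h : (!ps.isEmpty) = true) : ∃ p, p ∈ ps := by
    cases ps with
    | nil => simp at h
    | cons p _ => exact ⟨p, by simp⟩
  fun_induction avoidable k b ps with
  | case1 k ps =>
    obtain ⟨p, hp⟩ := nonempty h
    refine ⟨p, hp, fun i hi _ => ?_⟩
    by_contra hf
    have : i ∈ (Finset.range k).filter fun i => ¬ f i := by simp [hi, hf]
    simp [Finset.card_eq_zero.1 (Nat.le_zero.1 hb)] at this
  | case2 b ps =>
    obtain ⟨p, hp⟩ := nonempty h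
    exact ⟨p, hp, by simp⟩
  | case3 k b ps ih₁ ih₂ =>
    rw [Bool.and_eq_true] at h
    rw [Finset.range_add_one, Finset.filter_insert] at hb
    by_cases hk : f k
    · rw [if_neg (not_not.2 hk)] at hb
      obtain ⟨p, hp, hpf⟩ := ih₁ h.1 hb
      refine ⟨p, hp, fun i hi hpi => ?_⟩
      obtain hi | rfl := Nat.lt_succ_iff_lt_or_eq.1 hi
      exacts [hpf i hi hpi, hk]
    · rw [if_pos hk, Finset.card_insert_of_notMem (by simp), Nat.succ_le_succ_iff] at hb
      obtain ⟨p, hp, hpf⟩ := ih₂ h.2 hb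
      rw [List.mem_filter] at hp
      refine ⟨p, hp.1, fun i hi hpi => ?_⟩
      obtain hi | rfl := Nat.lt_succ_iff_lt_or_eq.1 hi
      · exact hpf i hi hpi
      · simp [hpi] at hp

theorem avoidable_fanMasks : avoidable 15 5 fanMasks = true := by decide +kernel

theorem testBit_edgeMask {l : List (Fin 6 × Fin 6)} {e : Fin 6 × Fin 6} (he : e ∈ l) :
    (edgeMask l).testBit (edgeCode e.1 e.2) = true := by
  induction l with
  | nil => simp at he
  | cons d l ih =>
    have hcons : edgeMask (d :: l) = 1 <<< edgeCode d.1 d.2 ||| edgeMask l := rfl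
    rw [hcons, Nat.testBit_or, Bool.or_eq_true]
    obtain rfl | he := List.mem_cons.1 he
    · left; simp [Nat.testBit_shiftLeft]
    · exact Or.inr (ih he)

theorem edgeCode_lt : ∀ i j : Fin 6, i ≠ j → edgeCode i j < 15 := by decide

theorem edgeCode_inj : ∀ i j k l : Fin 6, i ≠ j → k ≠ l → edgeCode i j = edgeCode k l →
    s(i, j) = s(k, l) := by decide +kernel

theorem hasDCC1_of_fanEdges {G : SimpleGraph (Fin 6)} {t : List (Fin 6)} (ht : t.Nodup)
    {l : List (Fin 6 × Fin 6)} (hl : l ∈ fanEdges t) (hadj : ∀ e ∈ l, G.Adj e.1 e.2) :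
    HasDCC1 G := by
  unfold fanEdges at hl
  split at hl
  · rename_i w a b c d e
    simp only [List.nodup_cons, List.mem_cons, List.not_mem_nil, not_or, or_false] at ht
    simp only [List.mem_cons, List.not_mem_nil, or_false] at hl
    obtain rfl | rfl | rfl := hl <;>
      simp only [List.forall_mem_cons, List.not_mem_nil, false_imp_iff, implies_true,
        and_true] at hadj
    · obtain ⟨wa, wb, wc, wd, ab, bc, cd⟩ := hadj
      apply hasDCC1_of_isPath (w := w) (x := b) (y := c)
        (Walk.cons ab (Walk.cons bc (Walk.cons cd Walk.nil))) <;> simp_all [eq_comm]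
    · obtain ⟨wa, wb, wc, we, ab, bc, cd, de⟩ := hadj
      apply hasDCC1_of_isPath (w := w) (x := b) (y := c)
        (Walk.cons ab (Walk.cons bc (Walk.cons cd (Walk.cons de Walk.nil)))) <;>
          simp_all [eq_comm]
    · obtain ⟨wa, wb, wd, we, ab, bc, cd, de⟩ := hadj
      apply hasDCC1_of_isPath (w := w) (x := b) (y := d)
        (Walk.cons ab (Walk.cons bc (Walk.cons cd (Walk.cons de Walk.nil)))) <;>
          simp_all [eq_comm]
  · simp at hl

theorem hasDCC1_of_ten_le_card_edgeFinset (G : SimpleGraph (Fin 6)) [DecidableRel G.Adj]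
    (hG : 10 ≤ G.edgeFinset.card) : HasDCC1 G := by
  classical
  let f : ℕ → Prop := fun k => ∃ i j, G.Adj i j ∧ edgeCode i j = k
  have hcard : G.edgeFinset.card ≤ ((Finset.range 15).filter f).card := by
    let code : Sym2 (Fin 6) → ℕ := Sym2.lift ⟨edgeCode, fun i j => by
      simp only [edgeCode, max_comm, min_comm]⟩
    refine Finset.card_le_card_of_injOn code ?_ ?_
    · intro e he
      induction e with
      | _ i j =>
        have hij : G.Adj i j := by simpa using he
        simpa using ⟨edgeCode_lt i j hij.ne, i, j, hij, rfl⟩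
    · intro e he e' he' heq
      induction e with
      | _ i j =>
        induction e' with
        | _ k l =>
          have hij : G.Adj i j := by simpa using he
          have hkl : G.Adj k l := by simpa using he'
          exact edgeCode_inj i j k l hij.ne hkl.ne heq
  have hmissing : ((Finset.range 15).filter fun i => ¬ f i).card ≤ 5 := by
    have := Finset.card_filter_add_card_filter_not (s := Finset.range 15) f
    rw [Finset.card_range] at this
    omega
  obtain ⟨p, hp, hpf⟩ := exists_mask_of_avoidable f 15 5 _ avoidable_fanMasks hmissing
  obtain ⟨l, hl, rfl⟩ := List.mem_map.1 hp
  obtain ⟨t, ht, hlt⟩ := List.mem_flatMap.1 hl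
  have htn : t.Nodup :=
    (List.mem_permutations'.1 ht).nodup_iff.2 (List.nodup_finRange 6)
  have hloop : ∀ e ∈ l, e.1 ≠ e.2 := by
    unfold fanEdges at hlt
    split at hlt
    · simp only [List.nodup_cons, List.mem_cons, List.not_mem_nil, not_or, or_false] at htn
      simp only [List.mem_cons, List.not_mem_nil, or_false] at hlt
      obtain rfl | rfl | rfl := hlt <;> simp_all
    · simp at hlt
  refine hasDCC1_of_fanEdges htn hlt fun e he => ?_
  obtain ⟨i, j, hij, hcode⟩ := hpf _ (edgeCode_lt _ _ (hloop e he)) (testBit_edgeMask he)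
  have := edgeCode_inj _ _ _ _ hij.ne (hloop e he) hcode
  rwa [← mem_edgeSet, ← this]

theorem card_edgeFinset_le_of_not_hasDCC1 (n : ℕ) (hn : 6 ≤ n) (V : Type) [Fintype V]
    [DecidableEq V] (hV : Fintype.card V = n) (G : SimpleGraph V) [DecidableRel G.Adj]
    (h : ¬ HasDCC1 G) : G.edgeFinset.card ≤ 3 * n - 9 := by
  classical
  induction n, hn using Nat.le_induction generalizing V with
  | base =>
    let φ := SimpleGraph.Iso.map (Fintype.equivFinOfCardEq hV) G
    by_contra! hlt
    rw [φ.card_edgeFinset_eq] at hlt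
    exact h ((hasDCC1_of_ten_le_card_edgeFinset _ hlt).map φ.symm.toEmbedding)
  | succ n hn ih =>
    have : Nonempty V := Fintype.card_pos_iff.1 (by omega)
    obtain ⟨v, hv⟩ : ∃ v, G.degree v < 4 := by
      by_contra! hdeg
      exact h (hasDCC1_of_four_le_degree G hdeg)
    have hcard : Fintype.card ({v}ᶜ : Set V) = n := by
      rw [Fintype.card_compl_set, hV]
      simp
    have hle := ih _ hcard (G.induce {v}ᶜ) fun h' => h (h'.map (Embedding.induce _))
    rw [card_edgeFinset_induce_compl_singleton, card_edgeFinset_deleteIncidenceSet] at hle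
    omega

theorem no_dcc1_edge_bound (n : ℕ) (hn : 6 ≤ n) (G : SimpleGraph (Fin n))
    (h : ¬ HasDCC1 G) : Nat.card G.edgeSet ≤ 3 * n - 9 := by
  classical
  rw [Nat.card_eq_fintype_card, ← edgeFinset_card]
  exact card_edgeFinset_le_of_not_hasDCC1 n hn (Fin n) (Fintype.card_fin n) G h
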